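/- Let $0<\beta<1$. The minimization problem $\min\{\int_{\mathbb{R}} w^{\beta}+\int_{\mathbb{R}}|w'|^2 \; : \; w\in H^1_{loc}(\mathbb{R},\mathbb{R}^+),\ \int_{\mathbb{R}} w = 1\}$ admits a minimizer $w$ which is even, non-increasing on $\mathbb{R}^+$, Lipschitz continuous on $\mathbb{R}$, compactly supported, and smooth on the open set $\{w>0\}$. -/

import Mathlib

open MeasureTheory intervalIntegral

/-- A function `w : ℝ → ℝ` is an admissible `H¹_loc(ℝ,ℝ⁺)` profile with
(weak) derivative `g`: it is nonnegative, locally absolutely continuous with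
`w b - w a = ∫_a^b g`, and `g ∈ L²_loc`. -/
def AdmissibleProfile (w g : ℝ → ℝ) : Prop :=
  Continuous w ∧ (∀ x, 0 ≤ w x) ∧ Measurable g ∧
    (∀ a b : ℝ, w b - w a = ∫ t in a..b, g t) ∧
    (∀ a b : ℝ, IntervalIntegrable (fun t => g t ^ 2) volume a b)

/-- The Cahn–Hilliard type energy `F^β(w) = ∫ w^β + ∫ |w'|²`, valued in
`[0,∞]`. -/
noncomputable def profileEnergy (β : ℝ) (w g : ℝ → ℝ) : ENNReal :=
  (∫⁻ x, ENNReal.ofReal (w x ^ β)) + ∫⁻ x, ENNReal.ofReal (g x ^ 2)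

open Set Filter Topology

/-- Chain rule in integrated form: `F ∘ w` is absolutely continuous when `w` is and `F` is `C¹`. -/
theorem comp_sub_comp_eq_integral {F f w g : ℝ → ℝ} (hf : Continuous f)
    (hF : ∀ s, HasDerivAt F (f s) s) (hg : ∀ a b, IntervalIntegrable g volume a b)
    (hw : ∀ a b, w b - w a = ∫ t in a..b, g t) (a b : ℝ) :
    F (w b) - F (w a) = ∫ t in a..b, f (w t) * g t := by
  have hw_eq : w = fun x => (∫ t in a..x, g t) + w a := by
    ext x; rw [← hw a x]; ring
  have hw_ac : AbsolutelyContinuousOnInterval w a b := by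
    have h1 := (hg a b).absolutelyContinuousOnInterval_intervalIntegral (c := a) (by simp)
    rw [absolutelyContinuousOnInterval_iff] at h1 ⊢
    rw [hw_eq]
    simpa using h1
  have hFw : AbsolutelyContinuousOnInterval (F ∘ w) a b := by
    obtain ⟨R, hR⟩ := hw_ac.exists_bound
    obtain ⟨C, hC⟩ := (isCompact_Icc (a := -R) (b := R)).exists_bound_of_continuousOn
      hf.continuousOn
    have hlip : ∀ x ∈ uIcc a b, ∀ y ∈ uIcc a b,
        dist (F (w x)) (F (w y)) ≤ |C| * dist (w x) (w y) := by
      intro x hx y hy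
      have hmem : ∀ z ∈ uIcc a b, w z ∈ Icc (-R) R := fun z hz => abs_le.mp (hR z hz)
      have := (convex_Icc (-R) R).norm_image_sub_le_of_norm_hasDerivWithin_le
        (f := F) (f' := f) (C := |C|) (fun s _ => (hF s).hasDerivWithinAt)
        (fun s hs => (hC s hs).trans (le_abs_self C)) (hmem y hy) (hmem x hx)
      simpa [dist_eq_norm] using this
    rw [absolutelyContinuousOnInterval_iff] at hw_ac ⊢
    intro ε hε
    obtain ⟨δ, hδ, H⟩ := hw_ac (ε / (|C| + 1)) (by positivity)
    refine ⟨δ, hδ, fun E hE hlt => ?_⟩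
    have h2 := H E hE hlt
    rw [lt_div_iff₀ (by positivity)] at h2
    refine lt_of_le_of_lt ?_ h2
    rw [Finset.sum_mul]
    refine Finset.sum_le_sum fun i hi => ?_
    have h3 := hE.1 i hi
    refine (hlip _ h3.1 _ h3.2).trans ?_
    rw [mul_comm]
    gcongr
    linarith
  rw [← Function.comp_apply (f := F), ← Function.comp_apply (f := F) (x := a),
    ← hFw.integral_deriv_eq_sub]
  apply intervalIntegral.integral_congr_ae
  filter_upwards [(hg a b).ae_hasDerivAt_integral] with x hx hxab
  have h4 := (hx (uIoc_subset_uIcc hxab) a (by simp)).add_const (w a)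
  rw [← hw_eq] at h4
  exact ((hF (w x)).comp x h4).deriv

theorem AdmissibleProfile.intervalIntegrable {w g : ℝ → ℝ} (h : AdmissibleProfile w g) (a b : ℝ) :
    IntervalIntegrable g volume a b := by
  obtain ⟨-, -, hm, -, hsq⟩ := h
  refine ((intervalIntegrable_const (c := (1 : ℝ))).add (hsq a b)).mono_fun
    hm.aestronglyMeasurable (ae_of_all _ fun x => ?_)
  simp only [Real.norm_eq_abs]
  refine le_trans ?_ (le_abs_self _)
  nlinarith [sq_abs (g x), sq_nonneg (|g x| - 1), abs_nonneg (g x)]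

/-- An integrable function has vanishing integrals over the unit windows going to infinity. -/
theorem tendsto_window_integral {f : ℝ → ℝ} (hf : Integrable f) :
    Tendsto (fun x => ∫ t in x..(x + 1), f t) (cocompact ℝ) (𝓝 0) := by
  have key : ∀ x, ∫ t in x..(x + 1), f t = (∫ t in 0..(x + 1), f t) - ∫ t in 0..x, f t :=
    fun x => (intervalIntegral.integral_interval_sub_left hf.intervalIntegrable
      hf.intervalIntegrable).symm
  simp only [key]
  rw [cocompact_eq_atBot_atTop, tendsto_sup]
  constructor
  · have h : Tendsto (fun x => ∫ t in 0..x, f t) atBot (𝓝 (-∫ t in Iic 0, f t)) := by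
      refine (intervalIntegral_tendsto_integral_Iic 0 hf.integrableOn tendsto_id).neg.congr
        fun x => ?_
      rw [intervalIntegral.integral_symm]; simp
    simpa using (h.comp (tendsto_atBot_add_const_right _ 1 tendsto_id)).sub h
  · have h : Tendsto (fun x => ∫ t in 0..x, f t) atTop (𝓝 (∫ t in Ioi 0, f t)) :=
      intervalIntegral_tendsto_integral_Ioi 0 hf.integrableOn tendsto_id
    simpa using (h.comp (tendsto_atTop_add_const_right _ 1 tendsto_id)).sub h

theorem AdmissibleProfile.tendsto_cocompact {w g : ℝ → ℝ} (h : AdmissibleProfile w g)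
    (hw : Integrable w) (hg : Integrable fun x => g x ^ 2) :
    Tendsto w (cocompact ℝ) (𝓝 0) := by
  have hgi := h.intervalIntegrable
  obtain ⟨hc, h0, hm, hint, -⟩ := h
  have bound : ∀ η > 0, ∀ x, w x ≤
      (∫ t in x..(x + 1), w t) + η / 2 + 1 / (2 * η) * ∫ t in x..(x + 1), g t ^ 2 := by
    intro η hη x
    have hx : x ≤ x + 1 := by linarith
    have hA : ∫ t in x..(x + 1), |g t| ≤ η / 2 + 1 / (2 * η) * ∫ t in x..(x + 1), g t ^ 2 := by
      have : ∫ t in x..(x + 1), |g t| ≤ ∫ t in x..(x + 1), (η / 2 + 1 / (2 * η) * g t ^ 2) := by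
        apply intervalIntegral.integral_mono_on hx (hgi _ _).abs
          (intervalIntegrable_const.add (hg.intervalIntegrable.const_mul _))
        intro t _
        have : η / 2 + 1 / (2 * η) * g t ^ 2 - |g t| = 1 / (2 * η) * (|g t| - η) ^ 2 := by
          rw [← sq_abs (g t)]; field_simp; ring
        have : 0 ≤ 1 / (2 * η) * (|g t| - η) ^ 2 := by positivity
        linarith
      rwa [intervalIntegral.integral_add intervalIntegrable_const
        (hg.intervalIntegrable.const_mul _), intervalIntegral.integral_const_mul,
        intervalIntegral.integral_const, add_sub_cancel_left, one_smul] at this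
    have hB : ∀ y ∈ Icc x (x + 1), w x ≤ w y + ∫ t in x..(x + 1), |g t| := by
      intro y hy
      have h1 : -(w y - w x) ≤ ∫ t in x..y, |g t| := by
        rw [hint x y]
        exact (neg_le_abs _).trans (intervalIntegral.abs_integral_le_integral_abs hy.1)
      have h2 : ∫ t in x..y, |g t| ≤ ∫ t in x..(x + 1), |g t| :=
        intervalIntegral.integral_mono_interval le_rfl hy.1 hy.2
          (ae_of_all _ fun t => abs_nonneg _) (hgi _ _).abs
      linarith
    have hC : ∫ _ in x..(x + 1), w x ≤
        ∫ y in x..(x + 1), (w y + ∫ t in x..(x + 1), |g t|) :=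
      intervalIntegral.integral_mono_on hx intervalIntegrable_const
        (hw.intervalIntegrable.add intervalIntegrable_const) hB
    rw [intervalIntegral.integral_add hw.intervalIntegrable intervalIntegrable_const,
      intervalIntegral.integral_const, intervalIntegral.integral_const, add_sub_cancel_left,
      one_smul, one_smul] at hC
    linarith
  rw [tendsto_order]
  refine ⟨fun a ha => Eventually.of_forall fun x => ha.trans_le (h0 x), fun ε hε => ?_⟩
  have hlim := ((tendsto_window_integral hw).add_const (ε / 2)).add
    ((tendsto_window_integral hg).const_mul (1 / (2 * ε)))
  have hlt : (0 : ℝ) + ε / 2 + 1 / (2 * ε) * 0 < ε := by simp; linarith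
  filter_upwards [hlim.eventually (gt_mem_nhds hlt)] with x hx
  exact (bound ε hε x).trans_lt hx

/-- The slope `|w'|` prescribed by the first integral `w'² = w^β - lam w` of the
Euler-Lagrange equation. -/
noncomputable def profileSlope (β lam s : ℝ) : ℝ := √(s ^ β - lam * s)

/-- The cost of rising from `0` to `y` with the slope `profileSlope β lam`. -/
noncomputable def riseCost (β lam y : ℝ) : ℝ := ∫ s in 0..y, profileSlope β lam s

theorem continuous_profileSlope {β : ℝ} (hβ : 0 < β) (lam : ℝ) :
    Continuous (profileSlope β lam) :=
  ((Real.continuous_rpow_const hβ.le).sub (continuous_const.mul continuous_id)).sqrt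

theorem hasDerivAt_riseCost {β : ℝ} (hβ : 0 < β) (lam s : ℝ) :
    HasDerivAt (riseCost β lam) (profileSlope β lam s) s :=
  intervalIntegral.integral_hasDerivAt_right
    ((continuous_profileSlope hβ lam).intervalIntegrable _ _)
    ((continuous_profileSlope hβ lam).stronglyMeasurableAtFilter _ _)
    (continuous_profileSlope hβ lam).continuousAt

theorem riseCost_zero (β lam : ℝ) : riseCost β lam 0 = 0 := by simp [riseCost]

theorem mul_le_rpow_of_le {β M s : ℝ} (hβ1 : β < 1) (hs : 0 ≤ s) (hsM : s ≤ M) :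
    M ^ (β - 1) * s ≤ s ^ β := by
  rcases hs.eq_or_lt with rfl | hs
  · simpa using Real.rpow_nonneg le_rfl β
  · calc M ^ (β - 1) * s ≤ s ^ (β - 1) * s := by
          gcongr ?_ * s
          exact Real.rpow_le_rpow_of_nonpos hs hsM (by linarith)
      _ = s ^ β := by
          conv_lhs => rw [← Real.rpow_one s, ← Real.rpow_mul hs.le, one_mul]
          rw [← Real.rpow_add hs]; ring_nf

theorem riseCost_eq_rpow_mul {β M : ℝ} (hM : 0 < M) :
    riseCost β (M ^ (β - 1)) M = M ^ (1 + β / 2) * riseCost β 1 1 := by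
  have h := intervalIntegral.smul_integral_comp_mul_left (a := 0) (b := 1)
    (profileSlope β (M ^ (β - 1))) M
  rw [mul_zero, mul_one] at h
  rw [riseCost, riseCost, ← h, smul_eq_mul, Real.rpow_add hM, Real.rpow_one, mul_assoc]
  congr 1
  rw [← intervalIntegral.integral_const_mul]
  apply intervalIntegral.integral_congr
  intro t ht
  rw [uIcc_of_le zero_le_one] at ht
  simp only [profileSlope]
  have h1 : (M * t) ^ β - M ^ (β - 1) * (M * t) = M ^ β * (t ^ β - 1 * t) := by
    rw [Real.mul_rpow hM.le ht.1, Real.rpow_sub_one hM.ne']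
    field_simp
  have h2 : √(M ^ β) = M ^ (β / 2) := by
    rw [Real.sqrt_eq_rpow, ← Real.rpow_mul hM.le]; ring_nf
  rw [h1, Real.sqrt_mul (by positivity), h2]

/-- Calibration bound: every admissible profile costs at least what a profile with the same
maximum `M` and slope `profileSlope β (M ^ (β - 1))` would cost. -/
theorem exists_le_profileEnergy {β : ℝ} (hβ0 : 0 < β) (hβ1 : β < 1) {w g : ℝ → ℝ}
    (h : AdmissibleProfile w g) (hw : Integrable w) (hw1 : ∫ x, w x = 1)
    (hfin : profileEnergy β w g ≠ ⊤) :
    ∃ M > 0, ENNReal.ofReal (M ^ (β - 1) + 4 * (M ^ (1 + β / 2) * riseCost β 1 1)) ≤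
      profileEnergy β w g := by
  have hgi := h.intervalIntegrable
  have hfin' := ENNReal.add_ne_top.mp hfin
  have hwβ : Continuous fun x => w x ^ β := h.1.rpow_const fun _ => Or.inr hβ0.le
  have hi1 : Integrable fun x => w x ^ β :=
    (lintegral_ofReal_ne_top_iff_integrable hwβ.aestronglyMeasurable
      (ae_of_all _ fun x => Real.rpow_nonneg (h.2.1 x) _)).mp hfin'.1
  have hi2 : Integrable fun x => g x ^ 2 :=
    (lintegral_ofReal_ne_top_iff_integrable (h.2.2.1.pow_const 2).aestronglyMeasurable
      (ae_of_all _ fun x => sq_nonneg _)).mp hfin'.2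
  have hlim := h.tendsto_cocompact hw hi2
  obtain ⟨hc, h0, hm, hint, -⟩ := h
  obtain ⟨y, hy⟩ : ∃ y, 0 < w y := by
    by_contra! hcon
    have : w = 0 := funext fun x => le_antisymm (hcon x) (h0 x)
    simp [this] at hw1
  obtain ⟨x₀, hx₀⟩ := hc.exists_forall_ge' y
    ((hlim.eventually (gt_mem_nhds hy)).mono fun _ => le_of_lt)
  set M := w x₀ with hMdef
  have hM : 0 < M := hy.trans_le (hx₀ y)
  refine ⟨M, hM, ?_⟩
  rw [← riseCost_eq_rpow_mul hM, profileEnergy,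
    ← ofReal_integral_eq_lintegral_ofReal hi1 (ae_of_all _ fun x => Real.rpow_nonneg (h0 x) _),
    ← ofReal_integral_eq_lintegral_ofReal hi2 (ae_of_all _ fun x => sq_nonneg _),
    ← ENNReal.ofReal_add (integral_nonneg fun x => Real.rpow_nonneg (h0 x) _)
      (integral_nonneg fun x => sq_nonneg _)]
  apply ENNReal.ofReal_le_ofReal
  set lam := M ^ (β - 1)
  have hpos : ∀ x, 0 ≤ w x ^ β - lam * w x := fun x =>
    sub_nonneg.mpr (mul_le_rpow_of_le hβ1 (h0 x) (hx₀ x))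
  have hJi : Integrable fun x => (w x ^ β - lam * w x) + g x ^ 2 :=
    (hi1.sub (hw.const_mul lam)).add hi2
  have hJ0 : ∀ x, 0 ≤ (w x ^ β - lam * w x) + g x ^ 2 := fun x =>
    add_nonneg (hpos x) (sq_nonneg _)
  have hJ : ∫ x, ((w x ^ β - lam * w x) + g x ^ 2) =
      (∫ x, w x ^ β) - lam + ∫ x, g x ^ 2 := by
    have h1 := integral_add (hi1.sub (hw.const_mul lam)) hi2
    have h2 := integral_sub hi1 (hw.const_mul lam)
    rw [MeasureTheory.integral_const_mul, hw1, mul_one] at h2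
    rw [← h2]
    exact h1
  have hstep : ∀ a b, a ≤ b → 2 * |riseCost β lam (w b) - riseCost β lam (w a)| ≤
      ∫ x in a..b, ((w x ^ β - lam * w x) + g x ^ 2) := by
    intro a b hab
    have hgs : IntervalIntegrable (fun t => profileSlope β lam (w t) * g t) volume a b :=
      (hgi a b).continuousOn_mul ((continuous_profileSlope hβ0 lam).comp hc).continuousOn
    rw [comp_sub_comp_eq_integral (continuous_profileSlope hβ0 lam)
      (hasDerivAt_riseCost hβ0 lam) hgi hint a b]
    refine (mul_le_mul_of_nonneg_left (intervalIntegral.abs_integral_le_integral_abs hab)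
      two_pos.le).trans ?_
    rw [← intervalIntegral.integral_const_mul]
    refine intervalIntegral.integral_mono_on hab (hgs.abs.const_mul 2) hJi.intervalIntegrable
      fun t _ => ?_
    have hsq : profileSlope β lam (w t) ^ 2 = w t ^ β - lam * w t := Real.sq_sqrt (hpos t)
    rw [← hsq, abs_mul]
    nlinarith [sq_nonneg (|profileSlope β lam (w t)| - |g t|), sq_abs (g t),
      sq_abs (profileSlope β lam (w t))]
  have hΦ : Continuous (riseCost β lam) :=
    continuous_iff_continuousAt.mpr fun s => (hasDerivAt_riseCost hβ0 lam s).continuousAt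
  have hgap : ∀ r, 0 ≤ r → 2 * (riseCost β lam M - riseCost β lam (w (x₀ - r))) +
      2 * (riseCost β lam M - riseCost β lam (w (x₀ + r))) ≤
      ∫ x, ((w x ^ β - lam * w x) + g x ^ 2) := by
    intro r hr
    have h1 := hstep (x₀ - r) x₀ (by linarith)
    have h2 := hstep x₀ (x₀ + r) (by linarith)
    have h3 := intervalIntegral.integral_add_adjacent_intervals
      (hJi.intervalIntegrable (a := x₀ - r) (b := x₀))
      (hJi.intervalIntegrable (a := x₀) (b := x₀ + r))
    have h4 : ∫ x in (x₀ - r)..(x₀ + r), ((w x ^ β - lam * w x) + g x ^ 2) ≤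
        ∫ x, ((w x ^ β - lam * w x) + g x ^ 2) := by
      rw [intervalIntegral.integral_of_le (by linarith)]
      exact setIntegral_le_integral hJi (ae_of_all _ hJ0)
    have h5 := le_abs_self (riseCost β lam (w x₀) - riseCost β lam (w (x₀ - r)))
    have h6 := neg_le_abs (riseCost β lam (w (x₀ + r)) - riseCost β lam (w x₀))
    linarith
  have hbot : Tendsto (fun r : ℝ => riseCost β lam (w (x₀ - r))) atTop (𝓝 0) := by
    rw [← riseCost_zero β lam]
    refine (hΦ.tendsto 0).comp (hlim.comp ?_)
    refine Tendsto.mono_right ?_ atBot_le_cocompact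
    exact tendsto_atBot_add_const_left _ x₀ tendsto_neg_atTop_atBot
  have htop : Tendsto (fun r : ℝ => riseCost β lam (w (x₀ + r))) atTop (𝓝 0) := by
    rw [← riseCost_zero β lam]
    refine (hΦ.tendsto 0).comp (hlim.comp ?_)
    exact (tendsto_atTop_add_const_left _ x₀ tendsto_id).mono_right atTop_le_cocompact
  have hfinal := le_of_tendsto (((hbot.const_sub (riseCost β lam M)).const_mul 2).add
    ((htop.const_sub (riseCost β lam M)).const_mul 2))
    ((eventually_ge_atTop 0).mono hgap)
  linarith

theorem exists_angle {q : ℝ} (hq : 0 < q) : ∃ Θ : ℝ → ℝ, StrictMono Θ ∧ Continuous Θ ∧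
    Function.Surjective Θ ∧ (∀ x, Θ (-x) = -Θ x) ∧
    ∀ x, |Θ x| < Real.pi / 2 →
      HasDerivAt Θ (Real.cos (Θ x) ^ q)⁻¹ x ∧ ContDiffAt ℝ (⊤ : ℕ∞) Θ x := by
  set ρ : ℝ → ℝ := fun t => |Real.cos t| ^ q with hρ
  have hρc : Continuous ρ := Real.continuous_cos.abs.rpow_const fun _ => Or.inr hq.le
  have hρi : ∀ a b, IntervalIntegrable ρ volume a b := fun a b => hρc.intervalIntegrable a b
  have hρ0 : ∀ t, 0 ≤ ρ t := fun t => by positivity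
  have hpos : ∀ a b, a < b → 0 < ∫ t in a..b, ρ t := by
    intro a b hab
    refine intervalIntegral.integral_pos hab hρc.continuousOn (fun t _ => hρ0 t) ?_
    suffices h : ∃ c ∈ Icc a b, Real.cos c ≠ 0 from
      h.imp fun c hc => ⟨hc.1, Real.rpow_pos_of_pos (abs_pos.mpr hc.2) q⟩
    by_cases ha : Real.cos a = 0
    · have hδ : 0 < min (b - a) 1 := lt_min (sub_pos.mpr hab) one_pos
      refine ⟨a + min (b - a) 1, ⟨by linarith, by linarith [min_le_left (b - a) 1]⟩, ?_⟩
      rw [Real.cos_add, ha, zero_mul, zero_sub, neg_ne_zero]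
      refine mul_ne_zero (fun hs => ?_) (Real.sin_pos_of_pos_of_lt_pi hδ
        (by linarith [min_le_right (b - a) 1, Real.pi_gt_three])).ne'
      simpa [ha, hs] using Real.sin_sq_add_cos_sq a
    · exact ⟨a, left_mem_Icc.mpr hab.le, ha⟩
  set X : ℝ → ℝ := fun θ => ∫ t in 0..θ, ρ t with hX
  have hXd : ∀ θ, HasDerivAt X (ρ θ) θ := fun θ =>
    intervalIntegral.integral_hasDerivAt_right (hρi _ _)
      (hρc.stronglyMeasurableAtFilter _ _) hρc.continuousAt
  have hXc : Continuous X := continuous_iff_continuousAt.mpr fun θ => (hXd θ).continuousAt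
  have hXm : StrictMono X := fun a b hab => by
    have := intervalIntegral.integral_interval_sub_left (hρi 0 b) (hρi 0 a)
    have := hpos a b hab
    simp only [hX]; linarith
  have hper : Function.Periodic ρ Real.pi := fun t => by simp [hρ, Real.cos_add_pi]
  have hXs : Function.Surjective X := hXc.surjective
    (hper.tendsto_atTop_intervalIntegral_of_pos (hpos _ _ Real.pi_pos) Real.pi_pos)
    (hper.tendsto_atBot_intervalIntegral_of_pos (hpos _ _ Real.pi_pos) Real.pi_pos)
  have hXodd : ∀ θ, X (-θ) = -X θ := fun θ => by
    have h := intervalIntegral.integral_comp_neg (a := 0) (b := θ) ρ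
    simp only [hρ, Real.cos_neg, neg_zero] at h
    simp only [hX]
    rw [h, intervalIntegral.integral_symm]
  set e := hXm.orderIsoOfSurjective X hXs
  have he : ∀ θ, e θ = X θ := fun θ => rfl
  refine ⟨e.symm, e.symm.strictMono, e.symm.continuous, e.symm.surjective, fun x => ?_,
    fun x hx => ?_⟩
  · rw [OrderIso.symm_apply_eq, he, hXodd, ← he, e.apply_symm_apply]
  · have hIoo : e.symm x ∈ Ioo (-(Real.pi / 2)) (Real.pi / 2) := abs_lt.mp hx
    have hcos : 0 < Real.cos (e.symm x) := Real.cos_pos_of_mem_Ioo hIoo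
    have hd : HasDerivAt X (Real.cos (e.symm x) ^ q) (e.symm x) := by
      simpa [hρ, abs_of_pos hcos] using hXd (e.symm x)
    have hne : Real.cos (e.symm x) ^ q ≠ 0 := (Real.rpow_pos_of_pos hcos q).ne'
    refine ⟨HasDerivAt.of_local_left_inverse e.symm.continuous.continuousAt hd hne
      (Eventually.of_forall fun y => e.apply_symm_apply y), ?_⟩
    refine e.toHomeomorph.toOpenPartialHomeomorph.contDiffAt_symm_deriv hne
      (mem_univ _) hd ?_
    have hon : ContDiffOn ℝ (⊤ : ℕ∞) X (Ioo (-(Real.pi / 2)) (Real.pi / 2)) := by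
      rw [contDiffOn_infty_iff_deriv_of_isOpen isOpen_Ioo]
      refine ⟨fun θ _ => (hXd θ).differentiableAt.differentiableWithinAt, ?_⟩
      have : ContDiffOn ℝ (⊤ : ℕ∞) (fun θ => Real.cos θ ^ q)
          (Ioo (-(Real.pi / 2)) (Real.pi / 2)) :=
        Real.contDiff_cos.contDiffOn.rpow_const_of_ne
          fun θ hθ => (Real.cos_pos_of_mem_Ioo hθ).ne'
      refine this.congr fun θ hθ => ?_
      rw [(hXd θ).deriv]
      simp [hρ, abs_of_pos (Real.cos_pos_of_mem_Ioo hθ)]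
    exact hon.contDiffAt (isOpen_Ioo.mem_nhds hIoo)

/-- The normalized optimal profile, of maximum `1` and first integral
`v² = 4 q² (u^β - u)` where `q = 1 / (1 - β)`. -/
theorem exists_unit_profile {β q : ℝ} (hβ0 : 0 < β) (hβ1 : β < 1) (hq : (1 - β) * q = 1) :
    ∃ (u v : ℝ → ℝ) (L : ℝ), 0 < L ∧ Continuous u ∧ Continuous v ∧ (∀ x, 0 ≤ u x) ∧ u 0 = 1 ∧
      (∀ x, u (-x) = u x) ∧ AntitoneOn u (Ici 0) ∧ (∀ x, 0 < u x ↔ |x| < L) ∧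
      (∀ a b, u b - u a = ∫ t in a..b, v t) ∧
      (∀ x, v x ^ 2 = 4 * q ^ 2 * (u x ^ β - u x)) ∧
      (∀ x, 0 ≤ x → v x ≤ 0) ∧ (∀ x, x ≤ 0 → 0 ≤ v x) ∧
      (∀ x, 0 < u x → ContDiffAt ℝ (⊤ : ℕ∞) u x) ∧
      ∀ a b, u b * v b - u a * v a =
        ∫ t in a..b, ((3 * q - 1) / (2 * q) * v t ^ 2 - 2 * q * u t) := by
  have hq1 : 1 < q := by nlinarith
  have hq0 : 0 < q := by linarith
  obtain ⟨Θ, hm, hΘc, hsurj, hodd, hreg⟩ := exists_angle hq0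
  have hπ : 0 < Real.pi / 2 := by positivity
  have hΘ0 : Θ 0 = 0 := by have := hodd 0; rw [neg_zero] at this; linarith
  obtain ⟨L, hL⟩ := hsurj (Real.pi / 2)
  have hin : ∀ x, |Θ x| < Real.pi / 2 ↔ |x| < L := fun x => by
    rw [abs_lt, abs_lt, ← hL, ← hodd, hm.lt_iff_lt, hm.lt_iff_lt]
  have hL0 : 0 < L := by rw [← hm.lt_iff_lt, hΘ0, hL]; exact hπ
  set c : ℝ → ℝ := fun x => Real.cos (min |Θ x| (Real.pi / 2)) with hc
  have hcc : Continuous c := Real.continuous_cos.comp (hΘc.abs.min continuous_const)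
  have hcin : ∀ x, |Θ x| < Real.pi / 2 → c x = Real.cos (Θ x) := fun x hx => by
    simp only [hc]; rw [min_eq_left hx.le, Real.cos_abs]
  have hcout : ∀ x, Real.pi / 2 ≤ |Θ x| → c x = 0 := fun x hx => by
    simp only [hc]; rw [min_eq_right hx, Real.cos_pi_div_two]
  have hcospos : ∀ x, |Θ x| < Real.pi / 2 → 0 < Real.cos (Θ x) := fun x hx =>
    Real.cos_pos_of_mem_Ioo (abs_lt.mp hx)
  have hc0 : ∀ x, 0 ≤ c x := fun x => by
    rcases lt_or_ge |Θ x| (Real.pi / 2) with hx | hx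
    · rw [hcin x hx]; exact (hcospos x hx).le
    · rw [hcout x hx]
  have hcpos : ∀ x, 0 < c x ↔ |Θ x| < Real.pi / 2 := fun x => by
    refine ⟨fun h => ?_, fun h => by rw [hcin x h]; exact hcospos x h⟩
    by_contra! hx
    rw [hcout x hx] at h
    exact h.false
  have hnear : ∀ x, |Θ x| < Real.pi / 2 → c =ᶠ[𝓝 x] fun y => Real.cos (Θ y) := fun x hx =>
    (hΘc.abs.continuousAt.eventually (gt_mem_nhds hx)).mono hcin
  have hfar : ∀ x, Real.pi / 2 < |Θ x| → c =ᶠ[𝓝 x] fun _ => 0 := fun x hx =>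
    (hΘc.abs.continuousAt.eventually (lt_mem_nhds hx)).mono fun y hy => hcout y (le_of_lt hy)
  have hcd : ∀ x, |Θ x| < Real.pi / 2 →
      HasDerivAt c (-Real.sin (Θ x) * (Real.cos (Θ x) ^ q)⁻¹) x := fun x hx =>
    ((Real.hasDerivAt_cos (Θ x)).comp x (hreg x hx).1).congr_of_eventuallyEq (hnear x hx)
  have hbd : ∀ x ∉ ({-L, L} : Set ℝ), Real.pi / 2 ≤ |Θ x| → Real.pi / 2 < |Θ x| := by
    refine fun x hxL hx => lt_of_le_of_ne hx fun h => hxL ?_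
    rcases abs_choice (Θ x) with h' | h'
    · exact Or.inr (hm.injective (by rw [hL, h, h']))
    · exact Or.inl (hm.injective (by rw [hodd, hL, h, h', neg_neg]))
  have hcount : ({-L, L} : Set ℝ).Countable := (Set.toFinite _).countable
  set u : ℝ → ℝ := fun x => c x ^ (2 * q) with hu
  set v : ℝ → ℝ := fun x => -(2 * q) * c x ^ (q - 1) * Real.sin (Θ x) with hv
  have hvc : Continuous v := (continuous_const.mul
    (hcc.rpow_const fun _ => Or.inr (by linarith))).mul (Real.continuous_sin.comp hΘc)
  have huc : Continuous u := hcc.rpow_const fun _ => Or.inr (by linarith)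
  have huv : ∀ x, u x * v x = -(2 * q) * c x ^ (3 * q - 1) * Real.sin (Θ x) := fun x => by
    have : c x ^ (3 * q - 1) = c x ^ (2 * q) * c x ^ (q - 1) := by
      rw [← Real.rpow_add_of_nonneg (hc0 x) (by linarith) (by linarith)]; ring_nf
    simp only [hu, hv, this]; ring
  have hΘnn : ∀ x, 0 ≤ x → 0 ≤ Θ x := fun x hx => hΘ0 ▸ hm.monotone hx
  have hvneg : ∀ x, 0 ≤ x → v x ≤ 0 := fun x hx => by
    rcases lt_or_ge |Θ x| (Real.pi / 2) with h | h
    · have hs : 0 ≤ Real.sin (Θ x) := Real.sin_nonneg_of_nonneg_of_le_pi (hΘnn x hx)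
        (by linarith [le_abs_self (Θ x)])
      have := mul_nonneg (mul_nonneg hq0.le (Real.rpow_nonneg (hc0 x) (q - 1))) hs
      simp only [hv]; linarith
    · simp only [hv]; rw [hcout x h, Real.zero_rpow (by linarith)]; simp
  have hceven : ∀ x, c (-x) = c x := fun x => by simp only [hc, hodd, abs_neg]
  refine ⟨u, v, L, hL0, huc, hvc, fun x => Real.rpow_nonneg (hc0 x) _, ?_, fun x => ?_, ?_,
    fun x => ?_, fun a b => ?_, fun x => ?_, hvneg, fun x hx => ?_, fun x hx => ?_,
    fun a b => ?_⟩
  · simp only [hu]; rw [hcin 0 (by simpa [hΘ0] using hπ), hΘ0]; simp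
  · simp only [hu, hceven]
  · intro x hx y hy hxy
    refine Real.rpow_le_rpow (hc0 y) ?_ (by linarith)
    have hle : |Θ x| ≤ |Θ y| := by
      rw [abs_of_nonneg (hΘnn x hx), abs_of_nonneg (hΘnn y hy)]; exact hm.monotone hxy
    exact Real.cos_le_cos_of_nonneg_of_le_pi (le_min (abs_nonneg _) hπ.le)
      ((min_le_right _ _).trans (by linarith)) (min_le_min_right _ hle)
  · rw [← hin, ← hcpos]
    refine ⟨fun h => (hc0 x).lt_of_ne fun h0 => ?_, fun h => Real.rpow_pos_of_pos h _⟩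
    simp only [hu] at h
    rw [← h0, Real.zero_rpow (by linarith)] at h
    exact h.false
  · refine (integral_eq_of_hasDerivAt_off_countable u v hcount huc.continuousOn
      (fun x hx => ?_) (hvc.intervalIntegrable _ _)).symm
    rcases lt_or_ge |Θ x| (Real.pi / 2) with h | h
    · have hC := hcospos x h
      have hd := (hcd x h).rpow_const (p := 2 * q) (Or.inl (by rw [hcin x h]; exact hC.ne'))
      refine hd.congr_deriv ?_
      have hs : Real.cos (Θ x) ^ (2 * q - 1) = Real.cos (Θ x) ^ q * Real.cos (Θ x) ^ (q - 1) := by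
        rw [← Real.rpow_add hC]; ring_nf
      have hne : Real.cos (Θ x) ^ q ≠ 0 := (Real.rpow_pos_of_pos hC q).ne'
      simp only [hv, hcin x h, hs]
      field_simp
    · have hf := hfar x (hbd x hx.2 h)
      have hv0 : v x = 0 := by
        simp only [hv]; rw [hcout x h, Real.zero_rpow (by linarith)]; simp
      rw [hv0]
      refine (hasDerivAt_const x (0 : ℝ)).congr_of_eventuallyEq (hf.mono fun y hy => ?_)
      simp only [hu]; rw [hy, Real.zero_rpow (by linarith)]
  · have huβ : u x ^ β = c x ^ (2 * q - 2) := by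
      simp only [hu]; rw [← Real.rpow_mul (hc0 x)]; congr 1; linear_combination -2 * hq
    have hsq : (c x ^ (q - 1)) ^ 2 = c x ^ (2 * q - 2) := by
      rw [← Real.rpow_natCast, ← Real.rpow_mul (hc0 x)]; congr 1; push_cast; ring
    rw [huβ]
    simp only [hv, hu, mul_pow, hsq]
    rcases lt_or_ge |Θ x| (Real.pi / 2) with h | h
    · have hC := hcospos x h
      have h2 : c x ^ (2 * q) = c x ^ (2 * q - 2) * Real.cos (Θ x) ^ 2 := by
        rw [hcin x h, ← Real.rpow_natCast, ← Real.rpow_add hC]; congr 1; push_cast; ring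
      rw [h2, Real.sin_sq]; ring
    · rw [hcout x h, Real.zero_rpow (by linarith), Real.zero_rpow (by linarith)]; ring
  · have h1 := hvneg (-x) (by linarith)
    simp only [hv, hceven, hodd, Real.sin_neg] at h1 ⊢
    linarith
  · have h : |Θ x| < Real.pi / 2 := by
      rw [← hcpos]
      refine (hc0 x).lt_of_ne fun h0 => ?_
      simp only [hu] at hx
      rw [← h0, Real.zero_rpow (by linarith)] at hx
      exact hx.false
    have hcos : ContDiffAt ℝ (⊤ : ℕ∞) (fun y => Real.cos (Θ y)) x :=
      Real.contDiff_cos.contDiffAt.comp x (hreg x h).2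
    exact (hcos.rpow_const_of_ne (hcospos x h).ne').congr_of_eventuallyEq
      ((hnear x h).mono fun y hy => by simp only [hu]; rw [hy])
  · refine (integral_eq_of_hasDerivAt_off_countable (fun x => u x * v x)
      (fun x => (3 * q - 1) / (2 * q) * v x ^ 2 - 2 * q * u x) hcount
      (huc.mul hvc).continuousOn (fun x hx => ?_) (Continuous.intervalIntegrable
        ((continuous_const.mul (hvc.pow 2)).sub (continuous_const.mul huc)) _ _)).symm
    rcases lt_or_ge |Θ x| (Real.pi / 2) with h | h
    · have hC := hcospos x h
      have hd := (((hcd x h).rpow_const (p := 3 * q - 1)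
        (Or.inl (by rw [hcin x h]; exact hC.ne'))).const_mul (-(2 * q))).mul
        ((Real.hasDerivAt_sin (Θ x)).comp x (hreg x h).1)
      refine (hd.congr_of_eventuallyEq (Eventually.of_forall huv)).congr_deriv ?_
      have h1 : Real.cos (Θ x) ^ (3 * q - 1 - 1) =
          Real.cos (Θ x) ^ q * (Real.cos (Θ x) ^ (q - 1)) ^ 2 := by
        rw [← Real.rpow_natCast, ← Real.rpow_mul hC.le, ← Real.rpow_add hC]
        congr 1; push_cast; ring
      have h2 : Real.cos (Θ x) ^ (3 * q - 1) * Real.cos (Θ x) =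
          Real.cos (Θ x) ^ q * Real.cos (Θ x) ^ (2 * q) := by
        rw [← Real.rpow_add hC, ← Real.rpow_add_one hC.ne']; ring_nf
      have hne : Real.cos (Θ x) ^ q ≠ 0 := (Real.rpow_pos_of_pos hC q).ne'
      simp only [hv, hu, hcin x h, Function.comp_apply, h1]
      generalize Real.cos (Θ x) ^ (3 * q - 1) = A at h2 ⊢
      field_simp
      linear_combination -(1 : ℝ) * h2
    · have hf := hfar x (hbd x hx.2 h)
      have hv0 : v x = 0 := by
        simp only [hv]; rw [hcout x h, Real.zero_rpow (by linarith)]; simp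
      have hu0 : u x = 0 := by simp only [hu]; rw [hcout x h, Real.zero_rpow (by linarith)]
      rw [hv0, hu0]
      refine ((hasDerivAt_const x (0 : ℝ)).congr_of_eventuallyEq (hf.mono fun y hy => ?_)).congr_deriv
        (by simp)
      simp only [hu]; rw [hy, Real.zero_rpow (by linarith), zero_mul]

/-- A critical point of `t ↦ t ^ s + B * t ^ r` on `(0, ∞)` is a global minimizer. -/
theorem rpow_add_mul_rpow_le_of_critical {s r B M N : ℝ} (hB : 0 ≤ B) (hM : 0 < M) (hN : 0 < N)
    (hcrit : s * M ^ s + r * (B * M ^ r) = 0) :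
    M ^ s + B * M ^ r ≤ N ^ s + B * N ^ r := by
  have key : ∀ e : ℝ, M ^ e * (1 + e * Real.log (N / M)) ≤ N ^ e := fun e => by
    have hMN : N ^ e = M ^ e * (N / M) ^ e := by
      rw [← Real.mul_rpow hM.le (by positivity), mul_div_cancel₀ _ hM.ne']
    rw [hMN, Real.rpow_def_of_pos (div_pos hN hM) e]
    gcongr
    linarith [Real.add_one_le_exp (Real.log (N / M) * e)]
  have h1 := key s
  have h2 := mul_le_mul_of_nonneg_left (key r) hB
  linear_combination h1 + h2 - Real.log (N / M) * hcrit

/-- Existence of a minimizer of `min{∫ w^β + ∫|w'|² : w ∈ H¹_loc(ℝ,ℝ⁺), ∫ w = 1}`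
(for `0 < β < 1`) which is even, non-increasing on `ℝ⁺`, Lipschitz, compactly
supported and smooth on `{w > 0}`. -/
theorem stmt_3 (β : ℝ) (hβ0 : 0 < β) (hβ1 : β < 1) :
    ∃ w g : ℝ → ℝ, AdmissibleProfile w g ∧ Integrable w ∧ (∫ x, w x) = 1 ∧
      (∀ w' g' : ℝ → ℝ, AdmissibleProfile w' g' → Integrable w' → (∫ x, w' x) = 1 →
        profileEnergy β w g ≤ profileEnergy β w' g') ∧
      (∀ x, w (-x) = w x) ∧ AntitoneOn w (Set.Ici 0) ∧
      (∃ K : NNReal, LipschitzWith K w) ∧ HasCompactSupport w ∧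
      ContDiffOn ℝ (⊤ : ℕ∞) w {x | 0 < w x} := by
  obtain ⟨q, hq⟩ : ∃ q : ℝ, (1 - β) * q = 1 :=
    ⟨(1 - β)⁻¹, mul_inv_cancel₀ (by linarith)⟩
  have hq1 : 1 < q := by nlinarith
  have hq0 : 0 < q := by linarith
  obtain ⟨u, v, L, hL, huc, hvc, hu0, hu1, hueven, huanti, hupos, hftc, hvsq, hvneg, hvpos,
    hsmooth, hvirial⟩ := exists_unit_profile hβ0 hβ1 hq
  have huout : ∀ x, L ≤ |x| → u x = 0 := fun x hx =>
    le_antisymm (not_lt.mp fun h => hx.not_gt ((hupos x).mp h)) (hu0 x)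
  have hvout : ∀ x, L ≤ |x| → v x = 0 := fun x hx => by
    have := hvsq x
    rw [huout x hx, Real.zero_rpow hβ0.ne', sub_zero, mul_zero] at this
    exact pow_eq_zero_iff two_ne_zero |>.mp this
  have hout : ∀ x ∉ Icc (-L) L, L ≤ |x| := fun x hx => by
    by_contra! h
    exact hx (abs_le.mp h.le)
  have husupp : HasCompactSupport u :=
    HasCompactSupport.intro isCompact_Icc fun x hx => huout x (hout x hx)
  have hvsupp : HasCompactSupport v :=
    HasCompactSupport.intro isCompact_Icc fun x hx => hvout x (hout x hx)
  have hui : Integrable u := huc.integrable_of_hasCompactSupport husupp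
  have hvi : Integrable fun x => v x ^ 2 := (hvc.pow 2).integrable_of_hasCompactSupport
    (HasCompactSupport.intro (isCompact_Icc (a := -L) (b := L)) fun x hx => by
      simp [hvout x (hout x hx)])
  have hm : 0 < ∫ x, u x :=
    huc.integral_pos_of_hasCompactSupport_nonneg_nonzero husupp hu0 (x := 0) (by simp [hu1])
  have hrestrict : ∀ f : ℝ → ℝ, (∀ x, L ≤ |x| → f x = 0) → ∫ x in -L..L, f x = ∫ x, f x :=
    fun f hf => intervalIntegral.integral_eq_integral_of_support_subset fun x hx => by
      have : |x| < L := not_le.mp fun h => hx (hf x h)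
      exact ⟨(abs_lt.mp this).1, (abs_lt.mp this).2.le⟩
  have huL := huout L (le_abs_self L)
  have huL' := huout (-L) (by rw [abs_neg]; exact le_abs_self L)
  have hvirial' : (3 * q - 1) / (2 * q) * (∫ x, v x ^ 2) = 2 * q * ∫ x, u x := by
    have h := hvirial (-L) L
    rw [huL, huL', intervalIntegral.integral_sub
      (hvi.intervalIntegrable.const_mul _) (hui.intervalIntegrable.const_mul _),
      intervalIntegral.integral_const_mul, intervalIntegral.integral_const_mul,
      hrestrict u huout, hrestrict (fun x => v x ^ 2) fun x hx => by simp [hvout x hx]] at h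
    linarith
  set c := riseCost β 1 1 with hc
  have hslope : ∀ x, profileSlope β 1 (u x) = |v x| / (2 * q) := fun x => by
    rw [profileSlope, one_mul, eq_div_iff (by positivity), ← Real.sqrt_sq_eq_abs, hvsq,
      show 4 * q ^ 2 * (u x ^ β - u x) = (u x ^ β - u x) * (2 * q) ^ 2 by ring,
      Real.sqrt_mul' _ (by positivity), Real.sqrt_sq (by positivity)]
  have hchain := comp_sub_comp_eq_integral (continuous_profileSlope hβ0 1)
    (hasDerivAt_riseCost hβ0 1) (fun a b => hvc.intervalIntegrable a b) hftc
  have hright : ∫ x in 0..L, v x ^ 2 = 2 * q * c := by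
    have h := hchain 0 L
    rw [huL, hu1, riseCost_zero, intervalIntegral.integral_congr
      (g := fun x => -(2 * q)⁻¹ * v x ^ 2), intervalIntegral.integral_const_mul, ← hc] at h
    · field_simp at h; linarith
    · intro x hx
      rw [uIcc_of_le hL.le] at hx
      simp only [hslope, abs_of_nonpos (hvneg x hx.1)]
      field_simp
  have hleft : ∫ x in -L..0, v x ^ 2 = 2 * q * c := by
    have h := hchain (-L) 0
    rw [huL', hu1, riseCost_zero, intervalIntegral.integral_congr
      (g := fun x => (2 * q)⁻¹ * v x ^ 2), intervalIntegral.integral_const_mul, ← hc] at h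
    · field_simp at h; linarith
    · intro x hx
      rw [uIcc_of_le (by linarith)] at hx
      simp only [hslope, abs_of_nonneg (hvpos x hx.2)]
      field_simp
  have hD : ∫ x, v x ^ 2 = 4 * q * c := by
    rw [← hrestrict (fun x => v x ^ 2) fun x hx => by simp [hvout x hx],
      ← intervalIntegral.integral_add_adjacent_intervals (hvi.intervalIntegrable (a := -L) (b := 0))
        hvi.intervalIntegrable, hleft, hright]
    ring
  have hcm : c * (3 * q - 1) = q * ∫ x, u x := by
    rw [hD] at hvirial'
    field_simp at hvirial'
    nlinarith
  have hc0 : 0 ≤ c := by nlinarith [mul_pos hq0 hm]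
  obtain ⟨M, hM, hMm⟩ : ∃ M > 0, M ^ (2 - β / 2) * (2 * q * ∫ x, u x) = 1 := by
    refine ⟨((2 * q * ∫ x, u x)⁻¹) ^ (2 - β / 2)⁻¹, by positivity, ?_⟩
    rw [← Real.rpow_mul (by positivity), inv_mul_cancel₀ (by linarith), Real.rpow_one,
      inv_mul_cancel₀ (by positivity)]
  set P := M ^ (1 - β / 2) with hP
  have hP0 : 0 < P := Real.rpow_pos_of_pos hM _
  set κ := (2 * q * P)⁻¹ with hκ
  have hκ0 : 0 < κ := by positivity
  have hMP : M * P = M ^ (2 - β / 2) := by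
    rw [hP, ← Real.rpow_one_add' hM.le (by linarith)]; ring_nf
  have hMβ : M ^ β * P ^ 2 = M ^ 2 := by
    rw [hP, ← Real.rpow_natCast, ← Real.rpow_mul hM.le, ← Real.rpow_add hM, ← Real.rpow_natCast]
    congr 1; push_cast; ring
  have hMr : M ^ (1 + β / 2) * P = M ^ 2 := by
    rw [hP, ← Real.rpow_add hM, ← Real.rpow_natCast]
    congr 1; push_cast; ring
  have hMlam : M ^ (β - 1) * M = M ^ β := by
    rw [← Real.rpow_add_one hM.ne']; ring_nf
  have hmass : ∫ x, M * u (κ * x) = 1 := by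
    rw [MeasureTheory.integral_const_mul, Measure.integral_comp_mul_left, smul_eq_mul,
      abs_of_pos (by positivity), hκ, inv_inv, ← hMm, ← hMP]
    ring
  have hg2 : ∫ x, (M * κ * v (κ * x)) ^ 2 = 2 * (M ^ (1 + β / 2) * c) := by
    simp only [mul_pow _ (v _)]
    rw [MeasureTheory.integral_const_mul, Measure.integral_comp_mul_left (fun x => v x ^ 2),
      smul_eq_mul, abs_of_pos (by positivity), hD, hκ, inv_inv]
    generalize M ^ (1 + β / 2) = R at hMr ⊢
    field_simp
    linear_combination -4 * c * hMr
  have hpt : ∀ x, (M * u (κ * x)) ^ β =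
      (M * κ * v (κ * x)) ^ 2 + M ^ (β - 1) * (M * u (κ * x)) := fun x => by
    rw [Real.mul_rpow hM.le (hu0 _), mul_pow _ (v _), hvsq, ← mul_assoc (M ^ (β - 1)), hMlam, hκ,
      mul_pow, ← hMβ]
    field_simp
    ring
  have hwi : Integrable fun x => M * u (κ * x) := (hui.comp_mul_left' hκ0.ne').const_mul M
  have hgi : Integrable fun x => (M * κ * v (κ * x)) ^ 2 := by
    simp only [mul_pow _ (v _)]
    exact (hvi.comp_mul_left' hκ0.ne').const_mul _
  have henergy : profileEnergy β (fun x => M * u (κ * x)) (fun x => M * κ * v (κ * x)) =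
      ENNReal.ofReal (M ^ (β - 1) + 4 * (M ^ (1 + β / 2) * c)) := by
    have hg0 : 0 ≤ ∫ x, (M * κ * v (κ * x)) ^ 2 := integral_nonneg fun x => sq_nonneg _
    have h0 : ∀ x, 0 ≤ (M * κ * v (κ * x)) ^ 2 + M ^ (β - 1) * (M * u (κ * x)) := fun x => by
      have := hu0 (κ * x)
      positivity
    have hsi : Integrable fun x =>
        (M * κ * v (κ * x)) ^ 2 + M ^ (β - 1) * (M * u (κ * x)) := hgi.add (hwi.const_mul _)
    simp only [profileEnergy, hpt]
    rw [← ofReal_integral_eq_lintegral_ofReal hsi (ae_of_all _ h0),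
      ← ofReal_integral_eq_lintegral_ofReal hgi (ae_of_all _ fun x => sq_nonneg _),
      ← ENNReal.ofReal_add (integral_nonneg h0) hg0,
      MeasureTheory.integral_add hgi (hwi.const_mul _),
      MeasureTheory.integral_const_mul (M ^ (β - 1)), hmass, hg2]
    ring_nf
  have hwftc : ∀ a b : ℝ, M * u (κ * b) - M * u (κ * a) = ∫ t in a..b, M * κ * v (κ * t) :=
    fun a b => by
      rw [← mul_sub, hftc, ← intervalIntegral.smul_integral_comp_mul_left,
        intervalIntegral.integral_const_mul, smul_eq_mul, mul_assoc]
  have hcκ : Continuous fun x : ℝ => κ * x := continuous_const.mul continuous_id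
  have hgc : Continuous fun x => M * κ * v (κ * x) := continuous_const.mul (hvc.comp hcκ)
  refine ⟨fun x => M * u (κ * x), fun x => M * κ * v (κ * x),
    ⟨continuous_const.mul (huc.comp hcκ), fun x => mul_nonneg hM.le (hu0 _), hgc.measurable,
      hwftc, fun a b => (hgc.pow 2).intervalIntegrable a b⟩, hwi, hmass, ?_, fun x => ?_, ?_, ?_,
    ?_, ?_⟩
  · intro w' g' hadm hint hone
    rcases eq_or_ne (profileEnergy β w' g') ⊤ with htop | hfin
    · rw [htop]; exact le_top
    obtain ⟨N, hN, hle⟩ := exists_le_profileEnergy hβ0 hβ1 hadm hint hone hfin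
    rw [henergy]
    refine (ENNReal.ofReal_le_ofReal ?_).trans hle
    have hcrit : (β - 1) * M ^ (β - 1) + (1 + β / 2) * (4 * c * M ^ (1 + β / 2)) = 0 := by
      have h1 : M ^ (1 + β / 2) = M ^ (β - 1) * M ^ (2 - β / 2) := by
        rw [← Real.rpow_add hM]; ring_nf
      have h2 : 4 * c * (1 + β / 2) * M ^ (2 - β / 2) = 1 - β := by
        have h3 : 4 * c * (1 + β / 2) = (1 - β) * (2 * q * ∫ x, u x) := by
          linear_combination 2 * (1 - β) * hcm - 6 * c * hq
        rw [h3]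
        linear_combination (1 - β) * hMm
      rw [h1]
      linear_combination M ^ (β - 1) * h2
    have := rpow_add_mul_rpow_le_of_critical (mul_nonneg four_pos.le hc0) hM hN hcrit
    linarith
  · simp only [mul_neg, hueven]
  · intro x hx y hy hxy
    exact mul_le_mul_of_nonneg_left (huanti (mul_nonneg hκ0.le hx) (mul_nonneg hκ0.le hy)
      (mul_le_mul_of_nonneg_left hxy hκ0.le)) hM.le
  · obtain ⟨C, hC⟩ := hvsupp.exists_bound_of_continuous hvc
    refine ⟨Real.toNNReal (M * κ * C), LipschitzWith.of_dist_le' fun x y => ?_⟩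
    rw [dist_comm, dist_comm x, Real.dist_eq, Real.dist_eq, hwftc,
      ← Real.norm_eq_abs]
    refine intervalIntegral.norm_integral_le_of_norm_le_const fun t _ => ?_
    rw [norm_mul, Real.norm_of_nonneg (by positivity : 0 ≤ M * κ)]
    exact mul_le_mul_of_nonneg_left (hC _) (by positivity)
  · refine HasCompactSupport.intro (isCompact_Icc (a := -(L / κ)) (b := L / κ)) fun x hx => ?_
    have hLx : L ≤ |κ * x| := by
      rw [abs_mul, abs_of_pos hκ0, mul_comm, ← div_le_iff₀ hκ0]
      by_contra! h
      exact hx (abs_le.mp h.le)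
    rw [huout _ hLx, mul_zero]
  · intro x hx
    have hx' : 0 < u (κ * x) := pos_of_mul_pos_right hx hM.le
    exact (contDiffAt_const.mul ((hsmooth _ hx').comp x
      (contDiffAt_const.mul contDiffAt_id))).contDiffWithinAt
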